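/- Let c ∈ ℂ and define ψ : ℝ³ \ {0} → ℂ by ψ(x) = e^{ic|x|}/(4π|x|), where |x| is the Euclidean norm. Then ψ satisfies the Helmholtz equation -Δψ - c²ψ = 0 on ℝ³ \ {0}. -/

import Mathlib

noncomputable section

/-- Partial derivative `∂ₖ` of a complex-valued function on Euclidean `ℝ³`. -/
def pd (k : Fin 3) (g : EuclideanSpace ℝ (Fin 3) → ℂ) (x : EuclideanSpace ℝ (Fin 3)) : ℂ :=
  fderiv ℝ g x (EuclideanSpace.single k 1)

/-- Embedding of a vector in `ℂ³` as a pure (vector-part) complex quaternion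
`v₁i₁ + v₂i₂ + v₃i₃`. -/
def vecQ (v : Fin 3 → ℂ) : Quaternion ℂ := ⟨0, v 0, v 1, v 2⟩

/-- Componentwise partial derivative of an `ℍ(ℂ)`-valued function. -/
def pdQ (k : Fin 3) (f : EuclideanSpace ℝ (Fin 3) → Quaternion ℂ)
    (x : EuclideanSpace ℝ (Fin 3)) : Quaternion ℂ :=
  ⟨pd k (fun y => (f y).re) x, pd k (fun y => (f y).imI) x,
   pd k (fun y => (f y).imJ) x, pd k (fun y => (f y).imK) x⟩

/-- The Moisil–Theodoresco operator `Df = i₁∂₁f + i₂∂₂f + i₃∂₃f`. -/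
def Dq (f : EuclideanSpace ℝ (Fin 3) → Quaternion ℂ) (x : EuclideanSpace ℝ (Fin 3)) :
    Quaternion ℂ :=
  vecQ ![1,0,0] * pdQ 0 f x + vecQ ![0,1,0] * pdQ 1 f x + vecQ ![0,0,1] * pdQ 2 f x

/-- Laplacian of a `ℂ`-valued function on Euclidean `ℝ³`. -/
def lap (h : EuclideanSpace ℝ (Fin 3) → ℂ) (x : EuclideanSpace ℝ (Fin 3)) : ℂ :=
  ∑ k : Fin 3, pd k (fun y => pd k h y) x

/-- The Euclidean norm is differentiable away from the origin, with gradient `x / ‖x‖`. -/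
theorem hasFDerivAt_norm_of_ne_zero {E : Type*} [NormedAddCommGroup E] [InnerProductSpace ℝ E]
    {x : E} (hx : x ≠ 0) : HasFDerivAt (fun y : E => ‖y‖) (‖x‖⁻¹ • innerSL ℝ x) x := by
  have h := (hasStrictFDerivAt_norm_sq x).hasFDerivAt.sqrt (by simpa using hx)
  have hr : ‖x‖ ≠ 0 := norm_ne_zero_iff.mpr hx
  simp only [Real.sqrt_sq (norm_nonneg _)] at h
  refine h.congr_fderiv ?_
  ext v
  simp
  field_simp

/-- Partial derivatives of a radial function. -/
theorem pd_comp_norm {f : ℝ → ℂ} {f' : ℂ} {x : EuclideanSpace ℝ (Fin 3)} (hx : x ≠ 0)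
    (hf : HasDerivAt f f' ‖x‖) (k : Fin 3) :
    pd k (fun y => f ‖y‖) x = f' / (‖x‖ : ℂ) * (x k : ℂ) := by
  have h : HasFDerivAt (fun y => f ‖y‖) _ x :=
    hf.hasFDerivAt.comp x (hasFDerivAt_norm_of_ne_zero hx)
  simp only [pd, h.fderiv]
  simp [EuclideanSpace.inner_single_right]
  ring

/-- Partial derivatives of a radial function multiplied by the matching coordinate. -/
theorem pd_comp_norm_mul_coord {g : ℝ → ℂ} {g' : ℂ} {x : EuclideanSpace ℝ (Fin 3)} (hx : x ≠ 0)
    (hg : HasDerivAt g g' ‖x‖) (k : Fin 3) :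
    pd k (fun y => g ‖y‖ * (y k : ℂ)) x = g' / (‖x‖ : ℂ) * (x k : ℂ) ^ 2 + g ‖x‖ := by
  have h : HasFDerivAt (fun y => g ‖y‖) _ x :=
    hg.hasFDerivAt.comp x (hasFDerivAt_norm_of_ne_zero hx)
  have hk : HasFDerivAt (fun y : EuclideanSpace ℝ (Fin 3) => (y k : ℂ))
      (Complex.ofRealCLM.comp (EuclideanSpace.proj k)) x :=
    (Complex.ofRealCLM.comp (EuclideanSpace.proj (𝕜 := ℝ) k)).hasFDerivAt
  have hmul : HasFDerivAt (fun y => g ‖y‖ * (y k : ℂ)) _ x := h.mul hk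
  simp only [pd, hmul.fderiv]
  simp [EuclideanSpace.inner_single_right]
  ring

/-- The Laplacian of a radial function on `ℝ³`, in terms of its radial derivatives. -/
theorem lap_comp_norm {f f' : ℝ → ℂ} {f'' : ℂ} {x : EuclideanSpace ℝ (Fin 3)} (hx : x ≠ 0)
    (hf : ∀ r, 0 < r → HasDerivAt f (f' r) r) (hf' : HasDerivAt f' f'' ‖x‖) :
    lap (fun y => f ‖y‖) x = f'' + 2 * f' ‖x‖ / (‖x‖ : ℂ) := by
  have hr : (‖x‖ : ℂ) ≠ 0 := by exact_mod_cast norm_ne_zero_iff.mpr hx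
  have hg : HasDerivAt (fun r : ℝ => f' r / (r : ℂ)) _ ‖x‖ :=
    hf'.div (Complex.ofRealCLM.hasDerivAt (x := ‖x‖)) hr
  have hpd (k : Fin 3) : pd k (fun y => pd k (fun z => f ‖z‖) y) x =
      pd k (fun y => f' ‖y‖ / (‖y‖ : ℂ) * (y k : ℂ)) x := by
    have h : (fun y => pd k (fun z => f ‖z‖) y) =ᶠ[nhds x]
        fun y => f' ‖y‖ / (‖y‖ : ℂ) * (y k : ℂ) := by
      filter_upwards [isOpen_ne.mem_nhds hx] with y hy
      exact pd_comp_norm hy (hf _ (norm_pos_iff.mpr hy)) k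
    simp only [pd] at h ⊢
    rw [h.fderiv_eq]
  have hsum : (x 0 : ℂ) ^ 2 + (x 1 : ℂ) ^ 2 + (x 2 : ℂ) ^ 2 = (‖x‖ : ℂ) ^ 2 := by
    have := EuclideanSpace.real_norm_sq_eq x
    rw [Fin.sum_univ_three] at this
    exact_mod_cast this.symm
  simp only [lap, hpd, pd_comp_norm_mul_coord hx hg, Fin.sum_univ_three]
  simp only [Complex.ofRealCLM_apply, Complex.ofReal_one, mul_one]
  field_simp
  linear_combination (f'' * (‖x‖ : ℂ) - f' ‖x‖) * hsum

/-- `ψ(x) = e^{ic|x|}/(4π|x|)` satisfies the Helmholtz equation `-Δψ - c²ψ = 0`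
on `ℝ³ \\ {0}`. -/
theorem helmholtz_fundamental_solution (c : ℂ) (x : EuclideanSpace ℝ (Fin 3)) (hx : x ≠ 0) :
    -lap (fun y => Complex.exp (Complex.I * c * (‖y‖ : ℂ)) / (4 * (Real.pi : ℂ) * (‖y‖ : ℂ))) x
        - c ^ 2 * (Complex.exp (Complex.I * c * (‖x‖ : ℂ)) / (4 * (Real.pi : ℂ) * (‖x‖ : ℂ)))
      = 0 := by
  have hr : (‖x‖ : ℂ) ≠ 0 := by exact_mod_cast norm_ne_zero_iff.mpr hx
  have hpi : (Real.pi : ℂ) ≠ 0 := by exact_mod_cast Real.pi_ne_zero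
  have hid (r : ℝ) : HasDerivAt (fun s : ℝ => (s : ℂ)) 1 r := by
    simpa using (hasDerivAt_id r).ofReal_comp
  have hexp (r : ℝ) : HasDerivAt (fun s : ℝ => Complex.exp (Complex.I * c * (s : ℂ)))
      (Complex.exp (Complex.I * c * (r : ℂ)) * (Complex.I * c)) r := by
    simpa using ((hid r).const_mul (Complex.I * c)).cexp
  have hf (r : ℝ) (hr : 0 < r) : HasDerivAt
      (fun s : ℝ => Complex.exp (Complex.I * c * (s : ℂ)) / (4 * (Real.pi : ℂ) * (s : ℂ)))
      (Complex.exp (Complex.I * c * (r : ℂ)) * (Complex.I * c * (r : ℂ) - 1) /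
        (4 * (Real.pi : ℂ) * (r : ℂ) ^ 2)) r := by
    have hr' : (r : ℂ) ≠ 0 := by exact_mod_cast hr.ne'
    refine ((hexp r).div ((hid r).const_mul (4 * (Real.pi : ℂ))) (by simp [hpi, hr'])).congr_deriv
      ?_
    field_simp
  have hf' := ((hexp ‖x‖).mul (((hid ‖x‖).const_mul (Complex.I * c)).sub_const 1)).div
    (((hid ‖x‖).pow 2).const_mul (4 * (Real.pi : ℂ))) (by simp [hpi, hr])
  rw [lap_comp_norm hx hf hf']
  simp only [Pi.mul_apply, Pi.pow_apply]
  field_simp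
  ring_nf
  simp only [Complex.I_sq]
  ring
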